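/- Assume in addition that ρ is continuously differentiable and let ‖ρ'‖_∞ = sup_{z ∈ [0,1]} |ρ'(z)|; let M ≥ 0, let U ≥ n be a positive integer, and set U' = 8U²(ρ_max + M)² and C = 16U⁴(ρ_max + M)⁴·(4ρ_max² + 2‖ρ'‖_∞ ρ_max). On a probability space with a filtration (ℱ_t)_{t ≥ 0}, let (x^{(t)})_{t ≥ 0} be an adapted ℝⁿ-valued process such that almost surely, for every t, 0 ≤ x₁^{(t)} ≤ ⋯ ≤ xₙ^{(t)} ≤ 1; let (g^{(t)})_{t ≥ 0} be random vectors in ℝⁿ with g^{(t)} measurable with respect to ℱ_{t+1}, E[g^{(t)} | ℱ_t] = ∇Q(x^{(t)}) almost surely, and ‖g^{(t)}‖₂² ≤ 64(ρ_max + M)⁴ almost surely; and suppose x^{(t+1)} = x^{(t)} − (α(t)/(16(ρ_max + M)²))·g^{(t)} for all t, with stepsize α(t) = U'/(U' + t). Then for every integer t ≥ 0, E[(1/n)·‖x^{(t)} − x*‖₂²] ≤ n·C/(U' + t) = 16nU⁴(ρ_max + M)⁴(4ρ_max² + 2‖ρ'‖_∞ ρ_max)/(8U²(ρ_max + M)²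 + t), where x* is the unique global minimizer of Q. -/

import Mathlib

open intervalIntegral MeasureTheory Filter

/-- `F(x) = ∫₀ˣ ρ(z) dz`. -/
noncomputable def Fint (ρ : ℝ → ℝ) (t : ℝ) : ℝ := ∫ z in (0 : ℝ)..t, ρ z

/-- The Lyapunov function
`Q(x₁,…,xₙ) = 2 F(x₁)² + Σ_{i=1}^{n-1} (F(x_{i+1}) - F(x_i))² + 2 (F(1) - F(xₙ))²`,
for `n+1` agents. -/
noncomputable def Qfun (ρ : ℝ → ℝ) (n : ℕ) (x : EuclideanSpace ℝ (Fin (n + 1))) : ℝ :=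
  2 * (Fint ρ (x 0)) ^ 2
    + (∑ i : Fin n, (Fint ρ (x i.succ) - Fint ρ (x i.castSucc)) ^ 2)
    + 2 * (Fint ρ 1 - Fint ρ (x (Fin.last n))) ^ 2


lemma Fint_hasDerivAt {ρ : ℝ → ℝ} (hc : Continuous ρ) (t : ℝ) :
    HasDerivAt (Fint ρ) (ρ t) t :=
  intervalIntegral.integral_hasDerivAt_right (hc.intervalIntegrable _ _)
    (hc.stronglyMeasurableAtFilter _ _) hc.continuousAt

lemma Fint_sub {ρ : ℝ → ℝ} (hc : Continuous ρ) (a b : ℝ) :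
    Fint ρ b - Fint ρ a = ∫ z in a..b, ρ z :=
  intervalIntegral.integral_interval_sub_left (hc.intervalIntegrable _ _)
    (hc.intervalIntegrable _ _)

lemma Fint_lower {ρ : ℝ → ℝ} (hc : Continuous ρ) (h1 : ∀ z, 1 ≤ ρ z) {a b : ℝ} (hab : a ≤ b) :
    b - a ≤ Fint ρ b - Fint ρ a := by
  rw [Fint_sub hc]
  have := intervalIntegral.integral_mono_on hab (f := fun _ => (1:ℝ)) (g := ρ) (μ := volume)
    (by simp) (hc.intervalIntegrable _ _) (fun z _ => h1 z)
  simpa using this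

lemma Fint_upper {ρ : ℝ → ℝ} (hc : Continuous ρ) {R : ℝ} (h1 : ∀ z, ρ z ≤ R) {a b : ℝ}
    (hab : a ≤ b) : Fint ρ b - Fint ρ a ≤ R * (b - a) := by
  rw [Fint_sub hc]
  have := intervalIntegral.integral_mono_on hab (g := fun _ => R) (f := ρ) (μ := volume)
    (hc.intervalIntegrable _ _) (by simp) (fun z _ => h1 z)
  simp at this
  linarith

lemma Fint_sq_lower {ρ : ℝ → ℝ} (hc : Continuous ρ) (h1 : ∀ z, 1 ≤ ρ z) (a b : ℝ) :
    (b - a) ^ 2 ≤ (Fint ρ b - Fint ρ a) ^ 2 := by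
  rcases le_total a b with h | h
  · have := Fint_lower hc h1 h
    nlinarith
  · have := Fint_lower hc h1 h
    nlinarith

lemma Fint_sq_upper {ρ : ℝ → ℝ} (hc : Continuous ρ) {R : ℝ} (h0 : ∀ z, 1 ≤ ρ z)
    (h1 : ∀ z, ρ z ≤ R) (a b : ℝ) :
    (Fint ρ b - Fint ρ a) ^ 2 ≤ R ^ 2 * (b - a) ^ 2 := by
  rw [← mul_pow]
  rcases le_total a b with h | h
  · have := Fint_lower hc h0 h
    have := Fint_upper hc h1 h
    nlinarith
  · have := Fint_lower hc h0 h
    have := Fint_upper hc h1 h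
    nlinarith

lemma Fint_taylor {ρ : ℝ → ℝ} (hd : ContDiff ℝ 1 ρ) {K : ℝ}
    (hK : ∀ z ∈ Set.Icc (0:ℝ) 1, |deriv ρ z| ≤ K) {a b : ℝ} (ha : a ∈ Set.Icc (0:ℝ) 1)
    (hb : b ∈ Set.Icc (0:ℝ) 1) :
    |Fint ρ b - Fint ρ a - ρ a * (b - a)| ≤ K / 2 * (b - a) ^ 2 := by
  have hc := hd.continuous
  have e : Fint ρ b - Fint ρ a - ρ a * (b - a) = ∫ z in a..b, (ρ z - ρ a) := by
    rw [Fint_sub hc, intervalIntegral.integral_sub (hc.intervalIntegrable _ _) (by simp)]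
    simp [mul_comm]
  rw [e, ← Real.norm_eq_abs]
  refine (intervalIntegral.norm_integral_le_integral_norm_uIoc).trans ?_
  have h2 := integral_pow_abs_sub_uIoc (a := a) (b := b) 1
  have h3 : ∫ z in Set.uIoc a b, ‖ρ z - ρ a‖ ≤ ∫ z in Set.uIoc a b, K * |z - a| ^ 1 := by
    apply setIntegral_mono_on
    · exact ((hc.sub continuous_const).norm).integrableOn_uIoc
    · exact Continuous.integrableOn_uIoc (by fun_prop)
    · exact measurableSet_uIoc
    · intro z hz
      have hz' : z ∈ Set.Icc (0:ℝ) 1 :=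
        (convex_Icc (0:ℝ) 1).ordConnected.uIcc_subset ha hb (Set.uIoc_subset_uIcc hz)
      have := (convex_Icc (0:ℝ) 1).norm_image_sub_le_of_norm_deriv_le (f := ρ) (C := K)
        (fun w _ => (hd.differentiable (by norm_num)).differentiableAt) hK ha hz'
      simpa using this
  refine h3.trans (le_of_eq ?_)
  rw [MeasureTheory.integral_const_mul, h2]
  norm_num
  ring

/-- Quadratic form in the transformed coordinates. -/
noncomputable def qq (L : ℝ) (n : ℕ) (y : Fin (n + 1) → ℝ) : ℝ :=
  2 * (y 0) ^ 2 + (∑ i : Fin n, (y i.succ - y i.castSucc) ^ 2) + 2 * (L - y (Fin.last n)) ^ 2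

/-- Derivative of `qq` at `y` in direction `v`. -/
noncomputable def BB (L : ℝ) (n : ℕ) (y v : Fin (n + 1) → ℝ) : ℝ :=
  4 * y 0 * v 0 + (∑ i : Fin n, 2 * (y i.succ - y i.castSucc) * (v i.succ - v i.castSucc))
    - 4 * (L - y (Fin.last n)) * v (Fin.last n)

/-- Extended differences. -/
noncomputable def DD (L : ℝ) (n : ℕ) (y : Fin (n + 1) → ℝ) : Fin (n + 2) → ℝ :=
  Fin.cons (2 * y 0)
    (Fin.snoc (α := fun _ => ℝ) (fun i : Fin n => y i.succ - y i.castSucc)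
      (2 * (L - y (Fin.last n))))

/-- Gradient of `qq`. -/
noncomputable def GG (L : ℝ) (n : ℕ) (y : Fin (n + 1) → ℝ) (i : Fin (n + 1)) : ℝ :=
  2 * (DD L n y i.castSucc - DD L n y i.succ)

lemma BB_eq_sum (L : ℝ) (n : ℕ) (y v : Fin (n + 1) → ℝ) :
    BB L n y v = ∑ i, GG L n y i * v i := by
  have h : ∀ i, GG L n y i * v i
      = 2 * (DD L n y i.castSucc * v i) - 2 * (DD L n y i.succ * v i) := by
    intro i; unfold GG; ring
  simp_rw [h]
  rw [Finset.sum_sub_distrib, Fin.sum_univ_succ, Fin.sum_univ_castSucc (n := n)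
    (f := fun i => 2 * (DD L n y i.succ * v i))]
  have h0 : DD L n y (Fin.castSucc 0) = 2 * y 0 := by simp [DD]
  have hl : DD L n y (Fin.last n).succ = 2 * (L - y (Fin.last n)) := by
    simp [DD]
  have hm : ∀ i : Fin n, DD L n y i.castSucc.succ = y i.succ - y i.castSucc := by
    intro i; simp [DD]
  have hm' : ∀ i : Fin n, DD L n y i.succ.castSucc = y i.succ - y i.castSucc := by
    intro i; rw [← Fin.succ_castSucc]; exact hm i
  simp_rw [hm, hm', h0, hl]
  unfold BB
  have : ∀ i : Fin n, 2 * (y i.succ - y i.castSucc) * (v i.succ - v i.castSucc)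
    = 2 * ((y i.succ - y i.castSucc) * v i.succ)
      - 2 * ((y i.succ - y i.castSucc) * v i.castSucc) := by intro i; ring
  simp_rw [this]
  rw [Finset.sum_sub_distrib]
  ring

lemma qq_add (L : ℝ) (n : ℕ) (y v : Fin (n + 1) → ℝ) :
    qq L n (y + v) = qq L n y + BB L n y v + qq 0 n v := by
  unfold qq BB
  have : ∀ i : Fin n, ((y + v) i.succ - (y + v) i.castSucc) ^ 2
    = (y i.succ - y i.castSucc) ^ 2 + 2 * (y i.succ - y i.castSucc) * (v i.succ - v i.castSucc)
      + (v i.succ - v i.castSucc) ^ 2 := by intro i; simp only [Pi.add_apply]; ring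
  simp_rw [this]
  rw [Finset.sum_add_distrib, Finset.sum_add_distrib]
  simp only [Pi.add_apply]
  ring

lemma BB_add (L : ℝ) (n : ℕ) (y v : Fin (n + 1) → ℝ) :
    BB L n (y + v) v = BB L n y v + 2 * qq 0 n v := by
  unfold qq BB
  have : ∀ i : Fin n, 2 * ((y + v) i.succ - (y + v) i.castSucc) * (v i.succ - v i.castSucc)
    = 2 * (y i.succ - y i.castSucc) * (v i.succ - v i.castSucc)
      + 2 * (v i.succ - v i.castSucc) ^ 2 := by intro i; simp only [Pi.add_apply]; ring
  simp_rw [this]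
  rw [Finset.sum_add_distrib, ← Finset.mul_sum (f := fun i : Fin n => (v i.succ - v i.castSucc)^2)]
  simp only [Pi.add_apply]
  ring

lemma qq_zero_le (n : ℕ) (v : Fin (n + 1) → ℝ) : qq 0 n v ≤ 4 * ∑ i, v i ^ 2 := by
  unfold qq
  have : ∑ i : Fin n, (v i.succ - v i.castSucc) ^ 2
      ≤ ∑ i : Fin n, (2 * v i.succ ^ 2 + 2 * v i.castSucc ^ 2) :=
    Finset.sum_le_sum fun i _ => by nlinarith [sq_nonneg (v i.succ + v i.castSucc)]
  rw [Finset.sum_add_distrib, ← Finset.mul_sum, ← Finset.mul_sum] at this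
  have h1 := Fin.sum_univ_succ (fun i => v i ^ 2)
  have h2 := Fin.sum_univ_castSucc (fun i => v i ^ 2)
  nlinarith

lemma poincare (n : ℕ) (v : Fin (n + 1) → ℝ) :
    ∑ i, v i ^ 2 ≤ ((n : ℝ) + 1) ^ 2 * qq 0 n v := by
  -- extended increments
  let w : Fin (n + 1) → ℝ := Fin.cons (v 0) (fun i : Fin n => v i.succ - v i.castSucc)
  have hw : ∑ j, w j ^ 2 ≤ qq 0 n v := by
    rw [Fin.sum_univ_succ]
    simp only [w, Fin.cons_zero, Fin.cons_succ]
    unfold qq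
    nlinarith [sq_nonneg (v 0), sq_nonneg (0 - v (Fin.last n))]
  have hv : ∀ i, v i = ∑ j ∈ Finset.Iic i, w j := by
    intro i
    induction i using Fin.induction with
    | zero =>
      have : (Finset.Iic (0 : Fin (n+1))) = {0} := by
        ext j; simp
      simp [this, w]
    | succ i ih =>
      have : Finset.Iic i.succ = insert i.succ (Finset.Iic i.castSucc) := by
        ext j
        simp only [Finset.mem_Iic, Finset.mem_insert, Fin.le_def, Fin.ext_iff, Fin.val_succ,
          Fin.val_castSucc]
        omega
      rw [this, Finset.sum_insert (by simp [Fin.le_def]), ← ih]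
      simp [w]
  have hi : ∀ i, v i ^ 2 ≤ ((n : ℝ) + 1) * qq 0 n v := by
    intro i
    have h1 := sq_sum_le_card_mul_sum_sq (s := Finset.Iic i) (f := w)
    have h2 : ∑ j ∈ Finset.Iic i, w j ^ 2 ≤ ∑ j, w j ^ 2 :=
      Finset.sum_le_univ_sum_of_nonneg fun j => sq_nonneg _
    have h3 : ((Finset.Iic i).card : ℝ) ≤ (n : ℝ) + 1 := by
      have := Finset.card_le_univ (Finset.Iic i)
      simp only [Fintype.card_fin] at this
      exact_mod_cast this
    have h4 : 0 ≤ ∑ j ∈ Finset.Iic i, w j ^ 2 := Finset.sum_nonneg fun j _ => sq_nonneg _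
    rw [hv i]
    calc _ ≤ _ := h1
      _ ≤ ((n : ℝ) + 1) * ∑ j ∈ Finset.Iic i, w j ^ 2 := by gcongr
      _ ≤ _ := by gcongr; linarith
  calc ∑ i, v i ^ 2 ≤ ∑ i : Fin (n + 1), ((n : ℝ) + 1) * qq 0 n v :=
        Finset.sum_le_sum fun i _ => hi i
    _ = _ := by simp; ring

lemma qq_nonneg (L : ℝ) (n : ℕ) (y : Fin (n + 1) → ℝ) : 0 ≤ qq L n y := by
  unfold qq
  positivity

/-- Gradient domination. -/
lemma PL (L : ℝ) (n : ℕ) (y v : Fin (n + 1) → ℝ) (h0 : BB L n y v = 0) :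
    4 * qq 0 n v ≤ ((n : ℝ) + 1) ^ 2 * ∑ i, GG L n (y + v) i ^ 2 := by
  have h1 := BB_add L n y v
  rw [h0, zero_add, BB_eq_sum] at h1
  have h2 := Finset.sum_mul_sq_le_sq_mul_sq Finset.univ (GG L n (y + v)) v
  rw [h1] at h2
  have h3 := poincare n v
  have h4 := qq_nonneg 0 n v
  have h5 : 0 ≤ ∑ i, GG L n (y + v) i ^ 2 := Finset.sum_nonneg fun j _ => sq_nonneg _
  rcases h4.eq_or_lt with h | h
  · rw [← h]; simp; positivity
  · have : (4 * qq 0 n v) * qq 0 n v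
        ≤ (((n : ℝ) + 1) ^ 2 * ∑ i, GG L n (y + v) i ^ 2) * qq 0 n v := by nlinarith
    exact le_of_mul_le_mul_right this h

lemma GG_bound (L : ℝ) (n : ℕ) (y : Fin (n + 1) → ℝ) (hy : ∀ i, y i ∈ Set.Icc 0 L)
    (hm : ∀ i j, i ≤ j → y i ≤ y j) (i : Fin (n + 1)) : |GG L n y i| ≤ 4 * L := by
  have hD : ∀ j, DD L n y j ∈ Set.Icc 0 (2 * L) := by
    intro j
    unfold DD
    refine Fin.cases ?_ (fun j => ?_) j
    · have := hy 0
      simp only [Fin.cons_zero, Set.mem_Icc] at *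
      constructor <;> linarith
    · rw [Fin.cons_succ]
      refine Fin.lastCases ?_ (fun j => ?_) j
      · have := hy (Fin.last n)
        simp only [Fin.snoc_last, Set.mem_Icc] at *
        constructor <;> linarith
      · rw [Fin.snoc_castSucc]
        have h1 := hy j.succ
        have h2 := hy j.castSucc
        have h3 := hm j.castSucc j.succ (by simp [Fin.le_def])
        simp only [Set.mem_Icc] at *
        constructor <;> linarith
  have h1 := hD i.castSucc
  have h2 := hD i.succ
  simp only [Set.mem_Icc] at *
  unfold GG
  rw [abs_le]
  constructor <;> linarith

lemma qq_bound (L : ℝ) (n : ℕ) (y : Fin (n + 1) → ℝ) (hy : ∀ i, y i ∈ Set.Icc 0 L) :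
    qq L n y ≤ 8 * ((n : ℝ) + 1) ^ 2 * L ^ 2 := by
  simp only [Set.mem_Icc] at hy
  unfold qq
  have h : ∑ i : Fin n, (y i.succ - y i.castSucc) ^ 2 ≤ ∑ i : Fin n, L ^ 2 := by
    apply Finset.sum_le_sum
    intro i _
    have h1 := hy i.succ
    have h2 := hy i.castSucc
    apply sq_le_sq'  <;> linarith
  simp at h
  have h1 : y 0 ^ 2 ≤ L ^ 2 := by have := hy 0; apply sq_le_sq' <;> linarith
  have h2 : (L - y (Fin.last n)) ^ 2 ≤ L ^ 2 := by
    have := hy (Fin.last n); apply sq_le_sq' <;> linarith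
  have hn : (0:ℝ) ≤ n := by positivity
  have : ((n:ℝ) + 4) * L ^ 2 ≤ 8 * ((n : ℝ) + 1) ^ 2 * L ^ 2 := by
    gcongr; nlinarith
  linarith

lemma Qfun_eq (ρ : ℝ → ℝ) (n : ℕ) (x : EuclideanSpace ℝ (Fin (n + 1))) :
    Qfun ρ n x = qq (Fint ρ 1) n (fun i => Fint ρ (x i)) := rfl

/-- The explicit gradient. -/
noncomputable def gradQ (ρ : ℝ → ℝ) (n : ℕ) (x : EuclideanSpace ℝ (Fin (n + 1))) :
    EuclideanSpace ℝ (Fin (n + 1)) :=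
  WithLp.toLp 2 (fun i => ρ (x i) * GG (Fint ρ 1) n (fun i => Fint ρ (x i)) i)

lemma gradQ_inner (ρ : ℝ → ℝ) (n : ℕ) (x h : EuclideanSpace ℝ (Fin (n + 1))) :
    inner ℝ (gradQ ρ n x) h
      = BB (Fint ρ 1) n (fun i => Fint ρ (x i)) (fun i => ρ (x i) * h i) := by
  rw [BB_eq_sum, PiLp.inner_apply]
  apply Finset.sum_congr rfl
  intro i _
  simp [gradQ]
  ring

lemma Qfun_hasGradientAt {ρ : ℝ → ℝ} (hc : Continuous ρ) (n : ℕ)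
    (x : EuclideanSpace ℝ (Fin (n + 1))) :
    HasGradientAt (Qfun ρ n) (gradQ ρ n x) x := by
  rw [hasGradientAt_iff_hasFDerivAt]
  have hF : ∀ i, HasFDerivAt (fun y : EuclideanSpace ℝ (Fin (n + 1)) => Fint ρ (y i))
      (ρ (x i) • (EuclideanSpace.proj i : EuclideanSpace ℝ (Fin (n + 1)) →L[ℝ] ℝ)) x := by
    intro i
    have h1 : HasFDerivAt (fun y : EuclideanSpace ℝ (Fin (n + 1)) => y i)
      (EuclideanSpace.proj i : EuclideanSpace ℝ (Fin (n + 1)) →L[ℝ] ℝ) x :=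
      (EuclideanSpace.proj i : EuclideanSpace ℝ (Fin (n + 1)) →L[ℝ] ℝ).hasFDerivAt
    exact (Fint_hasDerivAt hc (x i)).comp_hasFDerivAt x h1
  have hA := ((hF 0).pow 2).const_mul 2
  have hB := HasFDerivAt.fun_sum (u := Finset.univ)
    (fun (i : Fin n) _ => ((hF i.succ).sub (hF i.castSucc)).pow 2)
  have hC := (((hF (Fin.last n)).const_sub (Fint ρ 1)).pow 2).const_mul 2
  refine ((hA.add hB).add hC).congr_fderiv ?_
  ext h
  rw [InnerProductSpace.toDual_apply_apply, gradQ_inner]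
  simp [BB]
  rw [sub_eq_add_neg]
  congr 1
  · congr 1
    ring
  · ring

lemma gradQ_crit {ρ : ℝ → ℝ} (hc : Continuous ρ) (h1 : ∀ z, 1 ≤ ρ z) (n : ℕ)
    (xs : EuclideanSpace ℝ (Fin (n + 1))) (hmin : ∀ y, Qfun ρ n xs ≤ Qfun ρ n y)
    (v : Fin (n + 1) → ℝ) : BB (Fint ρ 1) n (fun i => Fint ρ (xs i)) v = 0 := by
  have hl : IsLocalMin (Qfun ρ n) xs := Filter.Eventually.of_forall hmin
  have h := hl.hasFDerivAt_eq_zero (Qfun_hasGradientAt hc n xs).hasFDerivAt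
  have h2 := congrArg (fun f => f (WithLp.toLp 2 fun i => v i / ρ (xs i))) h
  simp only [InnerProductSpace.toDual_apply_apply, gradQ_inner] at h2
  have : (fun i => ρ (xs i) * (v i / ρ (xs i))) = v := by
    ext i
    have := h1 (xs i)
    field_simp
  simpa [this] using h2

lemma gap_facts {ρ : ℝ → ℝ} (hc : Continuous ρ) (h1 : ∀ z, 1 ≤ ρ z) (n : ℕ)
    (xs : EuclideanSpace ℝ (Fin (n + 1))) (hmin : ∀ y, Qfun ρ n xs ≤ Qfun ρ n y)
    (x : EuclideanSpace ℝ (Fin (n + 1))) :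
    ‖x - xs‖ ^ 2 ≤ ((n : ℝ) + 1) ^ 2 * (Qfun ρ n x - Qfun ρ n xs) ∧
    4 * (Qfun ρ n x - Qfun ρ n xs) ≤ ((n : ℝ) + 1) ^ 2 * ‖gradQ ρ n x‖ ^ 2 := by
  set ys : Fin (n + 1) → ℝ := fun i => Fint ρ (xs i) with hys
  set v : Fin (n + 1) → ℝ := fun i => Fint ρ (x i) - Fint ρ (xs i) with hv
  have hy : (fun i => Fint ρ (x i)) = ys + v := by ext i; simp [hys, hv]
  have hB : BB (Fint ρ 1) n ys v = 0 := gradQ_crit hc h1 n xs hmin v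
  have hgap : Qfun ρ n x - Qfun ρ n xs = qq 0 n v := by
    rw [Qfun_eq, Qfun_eq, hy, qq_add, hB]; ring
  rw [hgap]
  constructor
  · refine le_trans ?_ (poincare n v)
    rw [EuclideanSpace.norm_sq_eq]
    apply Finset.sum_le_sum
    intro i _
    have := Fint_sq_lower hc h1 (xs i) (x i)
    simpa using this
  · refine (PL _ n ys v hB).trans ?_
    rw [← hy]
    gcongr
    rw [EuclideanSpace.norm_sq_eq]
    apply Finset.sum_le_sum
    intro i _
    simp only [gradQ, Real.norm_eq_abs, sq_abs]
    rw [mul_pow]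
    have := h1 (x i)
    have h2 : 1 ≤ ρ (x i) ^ 2 := by nlinarith
    nlinarith [sq_nonneg (GG (Fint ρ 1) n (fun i => Fint ρ (x i)) i)]

lemma Fint_mem {ρ : ℝ → ℝ} (hc : Continuous ρ) (h1 : ∀ z, 1 ≤ ρ z) {a : ℝ}
    (ha : a ∈ Set.Icc (0:ℝ) 1) : Fint ρ a ∈ Set.Icc 0 (Fint ρ 1) := by
  have h0 : Fint ρ 0 = 0 := by simp [Fint]
  have := Fint_lower hc h1 ha.1
  have := Fint_lower hc h1 ha.2
  have := ha.1
  have := ha.2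
  constructor <;> linarith

lemma Fint_one_le {ρ : ℝ → ℝ} (hc : Continuous ρ) {R : ℝ} (h1 : ∀ z, ρ z ≤ R) :
    Fint ρ 1 ≤ R := by
  have h0 : Fint ρ 0 = 0 := by simp [Fint]
  have := Fint_upper hc h1 (zero_le_one)
  linarith

lemma Qfun_bound {ρ : ℝ → ℝ} (hc : Continuous ρ) {R : ℝ} (h0 : ∀ z, 1 ≤ ρ z)
    (h1 : ∀ z, ρ z ≤ R) (n : ℕ) (x : EuclideanSpace ℝ (Fin (n + 1)))
    (hx : ∀ i, x i ∈ Set.Icc (0:ℝ) 1) : Qfun ρ n x ≤ 8 * ((n : ℝ) + 1) ^ 2 * R ^ 2 := by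
  rw [Qfun_eq]
  refine (qq_bound _ n _ (fun i => Fint_mem hc h0 (hx i))).trans ?_
  have := Fint_one_le hc h1
  have h := Fint_mem hc h0 (a := 0) (by simp)
  have := h.1.trans h.2
  gcongr

lemma gradQ_bound {ρ : ℝ → ℝ} (hc : Continuous ρ) {R : ℝ} (h0 : ∀ z, 1 ≤ ρ z)
    (h1 : ∀ z, ρ z ≤ R) (n : ℕ) (x : EuclideanSpace ℝ (Fin (n + 1)))
    (hx : ∀ i, x i ∈ Set.Icc (0:ℝ) 1) (hm : ∀ i j, i ≤ j → x i ≤ x j) (i : Fin (n + 1)) :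
    |GG (Fint ρ 1) n (fun i => Fint ρ (x i)) i| ≤ 4 * R := by
  refine (GG_bound _ n _ (fun i => Fint_mem hc h0 (hx i)) ?_ i).trans ?_
  · intro i j hij
    have := Fint_lower hc h0 (hm i j hij)
    have := hm i j hij
    linarith
  · have := Fint_one_le hc h1
    linarith

lemma descent {ρ : ℝ → ℝ} (hd : ContDiff ℝ 1 ρ) {R K : ℝ} (h0 : ∀ z, 1 ≤ ρ z)
    (h1 : ∀ z, ρ z ≤ R) (hK : ∀ z ∈ Set.Icc (0:ℝ) 1, |deriv ρ z| ≤ K)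
    (n : ℕ) (x x' : EuclideanSpace ℝ (Fin (n + 1)))
    (hx : ∀ i, x i ∈ Set.Icc (0:ℝ) 1) (hm : ∀ i j, i ≤ j → x i ≤ x j)
    (hx' : ∀ i, x' i ∈ Set.Icc (0:ℝ) 1) :
    Qfun ρ n x' ≤ Qfun ρ n x + inner ℝ (gradQ ρ n x) (x' - x)
      + (4 * R ^ 2 + 2 * K * R) * ‖x' - x‖ ^ 2 := by
  have hc := hd.continuous
  set y : Fin (n + 1) → ℝ := fun i => Fint ρ (x i) with hy
  set v : Fin (n + 1) → ℝ := fun i => Fint ρ (x' i) - Fint ρ (x i) with hv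
  have hy' : (fun i => Fint ρ (x' i)) = y + v := by ext i; simp [hy, hv]
  rw [Qfun_eq, hy', qq_add, Qfun_eq, gradQ_inner, BB_eq_sum, BB_eq_sum]
  have hq : qq 0 n v ≤ 4 * R ^ 2 * ‖x' - x‖ ^ 2 := by
    refine (qq_zero_le n v).trans ?_
    rw [EuclideanSpace.norm_sq_eq, mul_assoc]
    apply mul_le_mul_of_nonneg_left _ (by norm_num)
    rw [Finset.mul_sum]
    apply Finset.sum_le_sum
    intro i _
    have := Fint_sq_upper hc h0 h1 (x i) (x' i)
    simpa using this
  have hl : ∑ i, GG (Fint ρ 1) n y i * v i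
      ≤ ∑ i, GG (Fint ρ 1) n y i * (ρ (x i) * (x' - x) i) + 2 * K * R * ‖x' - x‖ ^ 2 := by
    rw [EuclideanSpace.norm_sq_eq, Finset.mul_sum, ← Finset.sum_add_distrib]
    apply Finset.sum_le_sum
    intro i _
    have hG := gradQ_bound hc h0 h1 n x hx hm i
    have hT := Fint_taylor hd hK (hx i) (hx' i)
    have hp := mul_le_mul hG hT (abs_nonneg _) ((abs_nonneg _).trans hG)
    rw [← abs_mul] at hp
    have := (le_abs_self _).trans hp
    simp only [PiLp.sub_apply, Real.norm_eq_abs, sq_abs, hv, hy] at this ⊢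
    linarith
  linarith

/-- (Convergence rate of Theorem 1.)  Let `ρ` be continuously
differentiable with `K = sup_{z ∈ [0,1]} |ρ'(z)|`, `M ≥ 0`, let `U ≥ n` be an integer
upper bound on the number of agents, and set `U' = 8U²(ρmax+M)²` and
`C = 16U⁴(ρmax+M)⁴(4ρmax² + 2Kρmax)`.  Let `(x^{(t)})` be an adapted process of a.s.
monotone configurations in `[0,1]ⁿ`, driven by
`x^{(t+1)} = x^{(t)} - (α(t)/(16(ρmax+M)²)) g^{(t)}` with the stepsize
`α(t) = U'/(U' + t)`, where `g^{(t)}` is `ℱ_{t+1}`-measurable, conditionally unbiased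
and a.s. bounded by `‖g^{(t)}‖₂² ≤ 64(ρmax+M)⁴`.  Then for every `t`,
`E[(1/n)‖x^{(t)} - x*‖₂²] ≤ n·C/(U' + t)`. -/
theorem stmt19 (n : ℕ) (ρ : ℝ → ℝ) (ρmax M : ℝ) (hρmax : 1 ≤ ρmax) (hM : 0 ≤ M)
    (hρdiff : ContDiff ℝ 1 ρ) (hρ : ∀ z, 1 ≤ ρ z ∧ ρ z ≤ ρmax)
    (K : ℝ) (hK : K = ⨆ z : Set.Icc (0 : ℝ) 1, |deriv ρ (z : ℝ)|)
    (xs : EuclideanSpace ℝ (Fin (n + 1)))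
    (hmin : ∀ y, Qfun ρ n xs ≤ Qfun ρ n y)
    (U : ℕ) (hU : n + 1 ≤ U)
    (U' C : ℝ)
    (hU' : U' = 8 * (U : ℝ) ^ 2 * (ρmax + M) ^ 2)
    (hC : C = 16 * (U : ℝ) ^ 4 * (ρmax + M) ^ 4 * (4 * ρmax ^ 2 + 2 * K * ρmax))
    {Ω : Type*} {m0 : MeasurableSpace Ω} (μ : Measure Ω) [IsProbabilityMeasure μ]
    (ℱ : Filtration ℕ m0)
    (x : ℕ → Ω → EuclideanSpace ℝ (Fin (n + 1)))
    (hadapted : Adapted ℱ x)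
    (hx01 : ∀ᵐ ω ∂μ, ∀ t, (∀ i, x t ω i ∈ Set.Icc (0 : ℝ) 1)
      ∧ (∀ i j : Fin (n + 1), i ≤ j → x t ω i ≤ x t ω j))
    (g : ℕ → Ω → EuclideanSpace ℝ (Fin (n + 1)))
    (hgmeas : ∀ t, StronglyMeasurable[ℱ (t + 1)] (g t))
    (hgmean : ∀ t, μ[g t|ℱ t] =ᵐ[μ] fun ω => gradient (Qfun ρ n) (x t ω))
    (hgbdd : ∀ t, ∀ᵐ ω ∂μ, ‖g t ω‖ ^ 2 ≤ 64 * (ρmax + M) ^ 4)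
    (α : ℕ → ℝ) (hα : ∀ t : ℕ, α t = U' / (U' + t))
    (hupdate : ∀ t ω, x (t + 1) ω = x t ω - (α t / (16 * (ρmax + M) ^ 2)) • g t ω) :
    ∀ t : ℕ, (1 / ((n : ℝ) + 1)) * ∫ ω, ‖x t ω - xs‖ ^ 2 ∂μ
      ≤ ((n : ℝ) + 1) * C / (U' + t) := by
  have hc := hρdiff.continuous
  have h0 : ∀ z, 1 ≤ ρ z := fun z => (hρ z).1
  have h1 : ∀ z, ρ z ≤ ρmax := fun z => (hρ z).2
  have hdc : Continuous (deriv ρ) := hρdiff.continuous_deriv (by norm_num)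
  have hKb : ∀ z ∈ Set.Icc (0:ℝ) 1, |deriv ρ z| ≤ K := by
    intro z hz
    have hbdd : BddAbove (Set.range fun z : Set.Icc (0 : ℝ) 1 => |deriv ρ (z : ℝ)|) := by
      have := (isCompact_Icc (a := (0:ℝ)) (b := 1)).bddAbove_image hdc.abs.continuousOn
      rwa [Set.image_eq_range] at this
    rw [hK]
    exact le_ciSup hbdd ⟨z, hz⟩
  have hK0 : 0 ≤ K := (abs_nonneg _).trans (hKb 0 (by simp))
  set P : ℝ := ρmax + M with hP
  have hP1 : 1 ≤ P := by linarith
  set A : ℝ := 4 * ρmax ^ 2 + 2 * K * ρmax with hA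
  have hA0 : 0 ≤ A := by positivity
  have hA4 : 4 * ρmax ^ 2 ≤ A := by
    have : 0 ≤ 2 * K * ρmax := by positivity
    linarith
  have hC0 : 0 ≤ C := by rw [hC]; positivity
  have hNU : (n : ℝ) + 1 ≤ U := by exact_mod_cast hU
  have hn0 : (0:ℝ) ≤ n := by positivity
  have hU1 : (1:ℝ) ≤ U := by linarith
  have hU8 : 8 ≤ U' := by
    rw [hU']
    have : 1 ≤ (U:ℝ) ^ 2 := by nlinarith
    have : 1 ≤ P ^ 2 := by nlinarith
    nlinarith
  have hQcont : Continuous (Qfun ρ n) := by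
    rw [continuous_iff_continuousAt]
    exact fun y => (Qfun_hasGradientAt hc n y).differentiableAt.continuousAt
  have hxm : ∀ t, Measurable (x t) := fun t => (hadapted t).mono (ℱ.le t) le_rfl
  have hQ0 : ∀ y, 0 ≤ Qfun ρ n y := fun y => by
    rw [Qfun_eq]; exact qq_nonneg _ _ _
  have hQb : ∀ t, ∀ᵐ ω ∂μ, Qfun ρ n (x t ω) ≤ 8 * ((n : ℝ) + 1) ^ 2 * ρmax ^ 2 := by
    intro t
    filter_upwards [hx01] with ω hω
    exact Qfun_bound hc h0 h1 n _ (hω t).1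
  have hQi : ∀ t, Integrable (fun ω => Qfun ρ n (x t ω)) μ := by
    intro t
    refine Integrable.of_bound (C := 8 * ((n : ℝ) + 1) ^ 2 * ρmax ^ 2)
      (hQcont.measurable.comp (hxm t)).aestronglyMeasurable ?_
    filter_upwards [hQb t] with ω hω
    rwa [Real.norm_eq_abs, abs_of_nonneg (hQ0 _)]
  have hQg : ∀ t, Integrable (fun ω => Qfun ρ n (x t ω) - Qfun ρ n xs) μ :=
    fun t => (hQi t).sub (integrable_const _)
  -- one step
  have hstep : ∀ t : ℕ, ∫ ω, (Qfun ρ n (x (t + 1) ω) - Qfun ρ n xs) ∂μ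
      ≤ (1 - 2 / (U' + t)) * ∫ ω, (Qfun ρ n (x t ω) - Qfun ρ n xs) ∂μ + C / (U' + t) ^ 2 := by
    intro t
    have hs : 0 < U' + t := by positivity
    have hgn : ∀ᵐ ω ∂μ, ‖g t ω‖ ≤ 8 * P ^ 2 := by
      filter_upwards [hgbdd t] with ω hω
      refine le_of_sq_le_sq ?_ (by positivity)
      nlinarith
    have hgsm : AEStronglyMeasurable (g t) μ :=
      ((hgmeas t).mono (ℱ.le (t + 1))).aestronglyMeasurable
    have hgi : Integrable (g t) μ := Integrable.of_bound hgsm _ hgn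
    set f := μ[g t|ℱ t] with hf
    have hfi : Integrable f μ := integrable_condExp
    have hfm : StronglyMeasurable[ℱ t] f := stronglyMeasurable_condExp
    have hfg : Integrable (fun ω => innerSL ℝ (f ω) (g t ω)) μ :=
      (innerSL ℝ).integrable_of_bilin_of_bdd_right (8 * P ^ 2) hfi hgsm hgn
    have hpull := condExp_bilin_of_stronglyMeasurable_left (innerSL ℝ) hfm hfg hgi
    have hff : Integrable (fun ω => innerSL ℝ (f ω) (f ω)) μ :=
      (integrable_condExp).congr hpull
    have hEq : ∫ ω, innerSL ℝ (f ω) (g t ω) ∂μ = ∫ ω, innerSL ℝ (f ω) (f ω) ∂μ := by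
      rw [← integral_condExp (ℱ.le t)]
      exact integral_congr_ae hpull
    have hfgrad : ∀ᵐ ω ∂μ, f ω = gradQ ρ n (x t ω) := by
      filter_upwards [hgmean t] with ω hω
      rw [hf, hω, (Qfun_hasGradientAt hc n (x t ω)).gradient]
    set s : ℝ := α t / (16 * P ^ 2) with hsdef
    have hs0 : 0 ≤ s := by
      rw [hsdef, hα]; positivity
    have hs1 : A * (s ^ 2 * (64 * P ^ 4)) = C / (U' + t) ^ 2 := by
      rw [hsdef, hα, hC, hU']
      rw [hU'] at hs
      field_simp
      ring
    have hs2 : 2 / (U' + t) ≤ s * (4 / ((n : ℝ) + 1) ^ 2) := by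
      have e : 2 / (U' + t) = s * (4 / (U : ℝ) ^ 2) := by
        rw [hsdef, hα]
        rw [hU'] at hs ⊢
        field_simp
        ring
      rw [e]
      gcongr
    have hdes : ∀ᵐ ω ∂μ, Qfun ρ n (x (t + 1) ω) - Qfun ρ n xs
        ≤ (Qfun ρ n (x t ω) - Qfun ρ n xs) - s * innerSL ℝ (f ω) (g t ω)
          + C / (U' + t) ^ 2 := by
      filter_upwards [hx01, hgbdd t, hfgrad] with ω h2 h3 h4
      have h5 := descent hρdiff h0 h1 hKb n (x t ω) (x (t + 1) ω) (h2 t).1 (h2 t).2 (h2 (t + 1)).1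
      have h6 : x (t + 1) ω - x t ω = - (s • g t ω) := by
        rw [hupdate t ω]; abel
      rw [h6, norm_neg, norm_smul, inner_neg_right, inner_smul_right, mul_pow, ← h4,
        Real.norm_eq_abs, sq_abs] at h5
      have h7 : A * (s ^ 2 * ‖g t ω‖ ^ 2) ≤ A * (s ^ 2 * (64 * P ^ 4)) := by gcongr
      rw [hs1] at h7
      simp only [innerSL_apply_apply]
      linarith
    have hPL : 4 / ((n : ℝ) + 1) ^ 2 * ∫ ω, (Qfun ρ n (x t ω) - Qfun ρ n xs) ∂μ
        ≤ ∫ ω, innerSL ℝ (f ω) (f ω) ∂μ := by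
      rw [← MeasureTheory.integral_const_mul]
      apply integral_mono_ae ((hQg t).const_mul _) hff
      filter_upwards [hfgrad] with ω h4
      have := (gap_facts hc h0 n xs hmin (x t ω)).2
      simp only [innerSL_apply_apply, real_inner_self_eq_norm_sq, h4]
      rw [div_mul_eq_mul_div, div_le_iff₀ (by positivity)]
      linarith
    have hI := integral_mono_ae (hQg (t + 1))
      (((hQg t).sub (hfg.const_mul s)).add (integrable_const (C / (U' + t) ^ 2))) hdes
    have hI2 : ∫ ω, (Qfun ρ n (x (t + 1) ω) - Qfun ρ n xs) ∂μ
        ≤ ∫ ω, (Qfun ρ n (x t ω) - Qfun ρ n xs) ∂μ - s * ∫ ω, innerSL ℝ (f ω) (g t ω) ∂μ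
          + C / (U' + t) ^ 2 := by
      refine hI.trans (le_of_eq ?_)
      rw [integral_add' ((hQg t).sub (hfg.const_mul s)) (integrable_const _),
        integral_sub' (hQg t) (hfg.const_mul s), MeasureTheory.integral_const_mul]
      simp
    rw [hEq] at hI2
    have he0 : 0 ≤ ∫ ω, (Qfun ρ n (x t ω) - Qfun ρ n xs) ∂μ :=
      integral_nonneg fun ω => sub_nonneg.2 (hmin _)
    have h8 := mul_le_mul_of_nonneg_left hPL hs0
    have h9 := mul_le_mul_of_nonneg_right hs2 he0
    linarith
  -- induction
  have hind : ∀ t : ℕ, ∫ ω, (Qfun ρ n (x t ω) - Qfun ρ n xs) ∂μ ≤ C / (U' + t) := by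
    intro t
    induction t with
    | zero =>
      have h2 : ∫ ω, (Qfun ρ n (x 0 ω) - Qfun ρ n xs) ∂μ
          ≤ ∫ _ω, 8 * ((n : ℝ) + 1) ^ 2 * ρmax ^ 2 ∂μ := by
        apply integral_mono_ae (hQg 0) (integrable_const _)
        filter_upwards [hQb 0] with ω hω
        have := hQ0 xs
        linarith
      have h3 : C / (U' + (0 : ℕ)) = 2 * (U : ℝ) ^ 2 * P ^ 2 * A := by
        rw [hC, hU']
        have : 0 < P := by linarith
        have : (0:ℝ) < U := by linarith
        push_cast
        field_simp
        ring
      rw [h3]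
      refine h2.trans ?_
      simp only [MeasureTheory.integral_const, probReal_univ, one_smul]
      have h4 : 1 ≤ P ^ 2 := by nlinarith
      calc 8 * ((n : ℝ) + 1) ^ 2 * ρmax ^ 2 ≤ 2 * (U:ℝ) ^ 2 * 1 * (4 * ρmax ^ 2) := by
            have : ((n : ℝ) + 1) ^ 2 * ρmax ^ 2 ≤ (U:ℝ) ^ 2 * ρmax ^ 2 := by gcongr
            linarith
        _ ≤ _ := by gcongr
    | succ t ih =>
      refine (hstep t).trans ?_
      have ht : (0:ℝ) ≤ t := by positivity
      set s : ℝ := U' + t with hs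
      have hs8 : 8 ≤ s := by linarith
      have e : U' + ((t + 1 : ℕ) : ℝ) = s + 1 := by push_cast; ring
      rw [e]
      have h2 : 0 ≤ 1 - 2 / s := by
        rw [sub_nonneg, div_le_one (by linarith)]; linarith
      have h3 := mul_le_mul_of_nonneg_left ih h2
      have h4 : (1 - 2 / s) * (C / s) + C / s ^ 2 = C * ((s - 1) / s ^ 2) := by
        field_simp
        ring
      have h5 : (s - 1) / s ^ 2 ≤ 1 / (s + 1) := by
        rw [div_le_div_iff₀ (by positivity) (by linarith)]
        nlinarith
      have h6 := mul_le_mul_of_nonneg_left h5 hC0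
      rw [mul_one_div] at h6
      linarith
  intro t
  have hfin : ∫ ω, ‖x t ω - xs‖ ^ 2 ∂μ
      ≤ ((n : ℝ) + 1) ^ 2 * ∫ ω, (Qfun ρ n (x t ω) - Qfun ρ n xs) ∂μ := by
    rw [← MeasureTheory.integral_const_mul]
    refine integral_mono_of_nonneg (Filter.Eventually.of_forall fun ω => by positivity)
      ((hQg t).const_mul _) (Filter.Eventually.of_forall fun ω => ?_)
    exact (gap_facts hc h0 n xs hmin (x t ω)).1
  calc (1 / ((n : ℝ) + 1)) * ∫ ω, ‖x t ω - xs‖ ^ 2 ∂μ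
      ≤ (1 / ((n : ℝ) + 1)) * (((n : ℝ) + 1) ^ 2 * (C / (U' + t))) := by
        gcongr
        exact hfin.trans (mul_le_mul_of_nonneg_left (hind t) (by positivity))
    _ = _ := by field_simp
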